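/- Δ has Property E if and only if h_k(Δ) = h_{d−k}(Δ) for every 0 ≤ k ≤ d, i.e. Property E is equivalent to the classical Dehn–Sommerville equations (symmetry of the h-vector). -/

import Mathlib

/-- `f_{i-1}(Δ)`: the number of faces of `Δ` of cardinality `i`. -/
def faceCount (n : ℕ) (Δ : Finset (Finset (Fin n))) (i : ℕ) : ℕ :=
  (Δ.filter fun σ => σ.card = i).card

/-- The `e`-vector: `e_k(Δ) = ∑_{i=k}^{d} (−1)^{i−k} (i choose k) f_{i−1}(Δ)`. -/
def eVec (n d : ℕ) (Δ : Finset (Finset (Fin n))) (k : ℕ) : ℤ :=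
  ∑ i ∈ Finset.Icc k d, (-1) ^ (i - k) * (i.choose k : ℤ) * (faceCount n Δ i : ℤ)

/-- The `h`-vector: `h_k(Δ) = ∑_{i=0}^{k} (−1)^{k−i} (d−i choose k−i) f_{i−1}(Δ)`. -/
def hVec (n d : ℕ) (Δ : Finset (Finset (Fin n))) (k : ℕ) : ℤ :=
  ∑ i ∈ Finset.range (k + 1), (-1) ^ (k - i) * ((d - i).choose (k - i) : ℤ) * (faceCount n Δ i : ℤ)

/-- Two sequences agree up to index `d` iff the associated polynomial functions agree on the
complement of a point. -/
lemma forall_le_eq_iff_sum_mul_pow_eq {K : Type*} [Field K] [Infinite K] (d : ℕ) (a b : ℕ → K)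
    (c : K) :
    (∀ k ≤ d, a k = b k) ↔ ∀ x ≠ c, ∑ k ∈ Finset.range (d + 1), a k * x ^ k =
      ∑ k ∈ Finset.range (d + 1), b k * x ^ k := by
  refine ⟨fun h x _ => Finset.sum_congr rfl fun k hk => ?_, fun h k hk => ?_⟩
  · rw [h k (by simpa [Nat.lt_succ_iff] using hk)]
  · have key : ∑ k ∈ Finset.range (d + 1), Polynomial.monomial k (a k) =
        ∑ k ∈ Finset.range (d + 1), Polynomial.monomial k (b k) := by
      refine Polynomial.eq_of_infinite_eval_eq _ _
        ((Set.finite_singleton c).infinite_compl.mono fun x hx => ?_)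
      simpa [Polynomial.eval_finsetSum] using h x hx
    have := congrArg (fun p => Polynomial.coeff p k) key
    simpa [Polynomial.finsetSum_coeff, Polynomial.coeff_monomial, Nat.lt_succ_iff, hk] using this

/-- The generating function of the `e`-vector is the `f`-polynomial evaluated at `y - 1`. -/
lemma sum_eVec_mul_pow (n d : ℕ) (Δ : Finset (Finset (Fin n))) (y : ℚ) :
    ∑ k ∈ Finset.range (d + 1), (eVec n d Δ k : ℚ) * y ^ k =
      ∑ i ∈ Finset.range (d + 1), (faceCount n Δ i : ℚ) * (y - 1) ^ i := by
  simp only [eVec, Int.cast_sum, Finset.sum_mul]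
  rw [Finset.sum_comm' (t' := Finset.range (d + 1)) (s' := fun i => Finset.range (i + 1))
    (by intro k i; simp only [Finset.mem_range, Finset.mem_Icc]; omega)]
  refine Finset.sum_congr rfl fun i _ => ?_
  rw [sub_eq_add_neg, add_pow, Finset.mul_sum]
  refine Finset.sum_congr rfl fun k _ => ?_
  push_cast
  ring

/-- The homogenized generating function of the `h`-vector in terms of the face numbers. -/
lemma sum_hVec_mul_pow_mul_pow (n d : ℕ) (Δ : Finset (Finset (Fin n))) (x y : ℚ) :
    ∑ k ∈ Finset.range (d + 1), (hVec n d Δ k : ℚ) * (x ^ k * y ^ (d - k)) =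
      ∑ i ∈ Finset.range (d + 1), (faceCount n Δ i : ℚ) * (x ^ i * (y - x) ^ (d - i)) := by
  simp only [hVec, Int.cast_sum, Finset.sum_mul]
  rw [Finset.sum_comm' (t' := Finset.range (d + 1)) (s' := fun i => Finset.Ico i (d + 1))
    (by intro k i; simp only [Finset.mem_range, Finset.mem_Ico]; omega)]
  refine Finset.sum_congr rfl fun i hi => ?_
  have hi : i ≤ d := by simpa [Nat.lt_succ_iff] using hi
  rw [Finset.sum_Ico_eq_sum_range, Nat.sub_add_comm hi, sub_eq_neg_add, add_pow,
    Finset.mul_sum, Finset.mul_sum]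
  refine Finset.sum_congr rfl fun j _ => ?_
  rw [Nat.add_sub_cancel_left, neg_pow x j, pow_add, Nat.sub_add_eq]
  push_cast
  ring

theorem propertyE_iff_dehn_sommerville
    (n d : ℕ) (Δ : Finset (Finset (Fin n)))
    (hempty : ∅ ∈ Δ)
    (hdown : ∀ σ ∈ Δ, ∀ τ ⊆ σ, τ ∈ Δ)
    (hd : 1 ≤ d)
    (hdim : ∀ σ ∈ Δ, σ.card ≤ d)
    (hmax : ∃ σ ∈ Δ, σ.card = d) :
    (∀ k ≤ d, eVec n d Δ k = (-1) ^ (d - k) * (faceCount n Δ k : ℤ)) ↔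
    (∀ k ≤ d, hVec n d Δ k = hVec n d Δ (d - k)) := by
  have hE := forall_le_eq_iff_sum_mul_pow_eq d (fun k => (eVec n d Δ k : ℚ))
    (fun k => (-1) ^ (d - k) * (faceCount n Δ k : ℚ)) 1
  have hH := forall_le_eq_iff_sum_mul_pow_eq d (fun k => (hVec n d Δ k : ℚ))
    (fun k => (hVec n d Δ (d - k) : ℚ)) 1
  have castE : (∀ k ≤ d, eVec n d Δ k = (-1) ^ (d - k) * (faceCount n Δ k : ℤ)) ↔
      ∀ k ≤ d, (eVec n d Δ k : ℚ) = (-1) ^ (d - k) * (faceCount n Δ k : ℚ) := by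
    refine forall₂_congr fun k _ => ?_
    rw [← Int.cast_inj (α := ℚ)]
    push_cast
    rfl
  have castH : (∀ k ≤ d, hVec n d Δ k = hVec n d Δ (d - k)) ↔
      ∀ k ≤ d, (hVec n d Δ k : ℚ) = (hVec n d Δ (d - k) : ℚ) := by
    simp only [Int.cast_inj]
  have hP (x : ℚ) : ∑ k ∈ Finset.range (d + 1), (hVec n d Δ k : ℚ) * x ^ k =
      ∑ i ∈ Finset.range (d + 1), (faceCount n Δ i : ℚ) * (x ^ i * (1 - x) ^ (d - i)) := by
    simpa using sum_hVec_mul_pow_mul_pow n d Δ x 1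
  have hQ (x : ℚ) : ∑ k ∈ Finset.range (d + 1), (hVec n d Δ (d - k) : ℚ) * x ^ k =
      ∑ i ∈ Finset.range (d + 1), (faceCount n Δ i : ℚ) * (x - 1) ^ (d - i) := by
    have h := sum_hVec_mul_pow_mul_pow n d Δ 1 x
    simp only [one_pow, one_mul] at h
    rw [← h, ← Finset.sum_range_reflect]
    refine Finset.sum_congr rfl fun k hk => ?_
    have hk : k ≤ d := by simpa [Nat.lt_succ_iff] using hk
    rw [Nat.add_sub_cancel, Nat.sub_sub_self hk]
  rw [castE, castH, hE, hH]
  simp only [sum_eVec_mul_pow, hP, hQ]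
  -- The substitution `x = 1 + u⁻¹`, `y = 1 + u` exchanges the two functional equations.
  have key (u : ℚ) (hu : u ≠ 0) :
      (∑ i ∈ Finset.range (d + 1), (faceCount n Δ i : ℚ) * (1 + u - 1) ^ i =
        ∑ k ∈ Finset.range (d + 1), (-1) ^ (d - k) * (faceCount n Δ k : ℚ) * (1 + u) ^ k) ↔
      (∑ i ∈ Finset.range (d + 1),
          (faceCount n Δ i : ℚ) * ((1 + u⁻¹) ^ i * (1 - (1 + u⁻¹)) ^ (d - i)) =
        ∑ i ∈ Finset.range (d + 1), (faceCount n Δ i : ℚ) * (1 + u⁻¹ - 1) ^ (d - i)) := by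
    rw [← mul_right_inj' (pow_ne_zero d hu) (b := ∑ i ∈ Finset.range (d + 1),
      (faceCount n Δ i : ℚ) * ((1 + u⁻¹) ^ i * (1 - (1 + u⁻¹)) ^ (d - i))), eq_comm,
      Finset.mul_sum, Finset.mul_sum]
    refine Eq.congr (Finset.sum_congr rfl fun i hi => ?_) (Finset.sum_congr rfl fun i hi => ?_)
    all_goals
      have hi : i ≤ d := by simpa [Nat.lt_succ_iff] using hi
      have hpow : u ^ d = u ^ i * u ^ (d - i) := by rw [← pow_add, Nat.add_sub_cancel' hi]
      rw [hpow]
    · have h₁ : (1 + u) ^ i = u ^ i * (1 + u⁻¹) ^ i := by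
        rw [← mul_pow, mul_add, mul_inv_cancel₀ hu, mul_one, add_comm]
      have h₂ : (-1 : ℚ) ^ (d - i) = u ^ (d - i) * (1 - (1 + u⁻¹)) ^ (d - i) := by
        rw [← mul_pow, sub_add_cancel_left, mul_neg, mul_inv_cancel₀ hu]
      rw [h₁, h₂]
      ring
    · have h₁ : u ^ (d - i) * (1 + u⁻¹ - 1) ^ (d - i) = 1 := by
        rw [← mul_pow, add_sub_cancel_left, mul_inv_cancel₀ hu, one_pow]
      rw [add_sub_cancel_left]
      linear_combination (-(faceCount n Δ i : ℚ) * u ^ i) * h₁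
  constructor
  · intro h x hx
    have hx' : x - 1 ≠ 0 := sub_ne_zero.mpr hx
    have := (key (x - 1)⁻¹ (inv_ne_zero hx')).mp (h _ (by simpa using hx'))
    simpa only [inv_inv, add_sub_cancel] using this
  · intro h y hy
    have hy' : y - 1 ≠ 0 := sub_ne_zero.mpr hy
    have := (key (y - 1) hy').mpr (h _ (by simpa using hy'))
    simpa only [add_sub_cancel] using this
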